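/- If p is a polynomial with real coefficients, of degree n ≥ 1, all of whose zeros lie in the strip {z : |Im z| ≤ μ}, and λ ≥ 0, then all zeros of q = Σ_{k=0}^{⌊n/2⌋} (−1)^k (λ^k/k!) p^{(2k)} (the action of exp(−λ D²) on p) lie in the strip {z : |Im z| ≤ δ} with δ = √(max(μ² − 2λ, 0)). -/

import Mathlib

open Complex Polynomial

open Filter Topology in
/-- If `f m = 1 + φ / (m + 1) + o(1 / m)` coefficientwise then `f m ^ (m + 1)` tends coefficientwise
to the exponential of `φ`, characterised by its differential equation. -/
theorem PowerSeries.tendsto_coeff_pow (f : ℕ → PowerSeries ℝ) (φ ψ : PowerSeries ℝ)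
    (hf₀ : ∀ m, PowerSeries.coeff 0 (f m) = 1)
    (hf : ∀ k, Tendsto (fun m : ℕ => ((m : ℝ) + 1) * PowerSeries.coeff (k + 1) (f m)) atTop
      (𝓝 (PowerSeries.coeff (k + 1) φ)))
    (hψ₀ : PowerSeries.coeff 0 ψ = 1)
    (hψ : PowerSeries.derivative ℝ ψ = PowerSeries.derivative ℝ φ * ψ) (k : ℕ) :
    Tendsto (fun m : ℕ => PowerSeries.coeff k (f m ^ (m + 1))) atTop
      (𝓝 (PowerSeries.coeff k ψ)) := by
  have hsmall : ∀ k, Tendsto (fun m : ℕ => PowerSeries.coeff k (f m - 1)) atTop (𝓝 0) := by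
    intro k
    rcases k with _ | k
    · simp only [map_sub, hf₀]
      simp
    · have h := tendsto_one_div_add_atTop_nhds_zero_nat (𝕜 := ℝ) |>.mul (hf k)
      rw [zero_mul] at h
      refine h.congr fun m => ?_
      have : (m : ℝ) + 1 ≠ 0 := by positivity
      rw [map_sub, PowerSeries.coeff_one, if_neg (Nat.succ_ne_zero k)]
      field_simp
      ring
  induction k using Nat.strong_induction_on with
  | _ k ih =>
  rcases k with _ | k
  · simp only [PowerSeries.coeff_zero_eq_constantCoeff, map_pow] at hf₀ hψ₀ ⊢
    simp [hf₀, hψ₀]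
  · have hrec : ∀ m : ℕ, PowerSeries.coeff (k + 1) (f m ^ (m + 1)) =
        ((∑ x ∈ Finset.HasAntidiagonal.antidiagonal k,
            (((m : ℝ) + 1) * PowerSeries.coeff (x.1 + 1) (f m)) * (x.1 + 1) *
              PowerSeries.coeff x.2 (f m ^ (m + 1))) -
          ∑ x ∈ Finset.HasAntidiagonal.antidiagonal k, PowerSeries.coeff x.1 (f m - 1) *
            (PowerSeries.coeff (x.2 + 1) (f m ^ (m + 1)) * (x.2 + 1))) / (k + 1) := by
      intro m
      have hode : PowerSeries.derivative ℝ (f m ^ (m + 1)) =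
          PowerSeries.C ((m : ℝ) + 1) * (PowerSeries.derivative ℝ (f m) * f m ^ (m + 1)) -
            (f m - 1) * PowerSeries.derivative ℝ (f m ^ (m + 1)) := by
        rw [PowerSeries.derivative_pow]
        simp only [Nat.cast_add, Nat.cast_one, Nat.add_sub_cancel, map_add, map_natCast, map_one]
        ring
      have h := congrArg (PowerSeries.coeff k) hode
      rw [PowerSeries.coeff_derivative, map_sub, PowerSeries.coeff_C_mul, PowerSeries.coeff_mul,
        PowerSeries.coeff_mul, Finset.mul_sum] at h
      simp only [PowerSeries.coeff_derivative] at h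
      rw [eq_div_iff (by positivity), h]
      congr 1
      exact Finset.sum_congr rfl fun x _ => by ring
    have hlim : PowerSeries.coeff (k + 1) ψ =
        ((∑ x ∈ Finset.HasAntidiagonal.antidiagonal k, PowerSeries.coeff (x.1 + 1) φ *
            (x.1 + 1) * PowerSeries.coeff x.2 ψ) -
          ∑ x ∈ Finset.HasAntidiagonal.antidiagonal k, (0 : ℝ)) / (k + 1) := by
      have h := congrArg (PowerSeries.coeff k) hψ
      rw [PowerSeries.coeff_derivative, PowerSeries.coeff_mul] at h
      simp only [PowerSeries.coeff_derivative] at h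
      rw [eq_div_iff (by positivity), h, Finset.sum_const_zero, sub_zero]
    simp only [hrec]
    rw [hlim]
    refine ((tendsto_finsetSum _ fun x hx => ?_).sub
      (tendsto_finsetSum _ fun x hx => ?_)).div_const _
    · have := Finset.HasAntidiagonal.mem_antidiagonal.mp hx
      exact ((hf x.1).mul_const _).mul (ih x.2 (by omega))
    · have := Finset.HasAntidiagonal.mem_antidiagonal.mp hx
      rcases Nat.eq_zero_or_pos x.1 with h0 | h0
      · simp only [h0, map_sub, hf₀]
        simp
      · have h := (hsmall x.1).mul ((ih (x.2 + 1) (by omega)).mul_const ((x.2 : ℝ) + 1))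
        rwa [zero_mul] at h

/-- The truncation below degree `N` of a power series in `d/dX`, applied to `p`. -/
noncomputable def Polynomial.diffOp (N : ℕ) (f : PowerSeries ℝ) (p : ℝ[X]) : ℝ[X] :=
  ∑ k ∈ Finset.range N, C (PowerSeries.coeff k f) * derivative^[k] p

theorem Polynomial.natDegree_diffOp_le (N : ℕ) (f : PowerSeries ℝ) (p : ℝ[X]) :
    (diffOp N f p).natDegree ≤ p.natDegree :=
  natDegree_sum_le_of_forall_le _ _ fun k _ =>
    (natDegree_C_mul_le _ _).trans ((natDegree_iterate_derivative p k).trans (Nat.sub_le _ _))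

theorem Polynomial.coeff_natDegree_diffOp {N : ℕ} (f : PowerSeries ℝ) {p : ℝ[X]}
    (hN : p.natDegree < N) :
    (diffOp N f p).coeff p.natDegree = PowerSeries.coeff 0 f * p.leadingCoeff := by
  rw [diffOp, finsetSum_coeff, Finset.sum_eq_single 0]
  · simp
  · intro k _ hk
    rw [coeff_C_mul, coeff_iterate_derivative, coeff_eq_zero_of_natDegree_lt (by omega)]
    simp
  · intro h
    exact absurd (Finset.mem_range.mpr (by omega)) h

theorem Polynomial.diffOp_eq_aeval {N : ℕ} (f : PowerSeries ℝ) (p : ℝ[X]) :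
    diffOp N f p = aeval (derivative : ℝ[X] →ₗ[ℝ] ℝ[X]) (PowerSeries.trunc N f) p := by
  rcases N with _ | N
  · simp [diffOp, PowerSeries.trunc_apply]
  · rw [aeval_eq_sum_range' (PowerSeries.natDegree_trunc_lt f N), LinearMap.sum_apply, diffOp]
    refine Finset.sum_congr rfl fun k hk => ?_
    rw [PowerSeries.coeff_trunc, if_pos (Finset.mem_range.mp hk), LinearMap.smul_apply,
      Module.End.pow_apply, smul_eq_C_mul]

theorem Polynomial.aeval_derivative_eq_diffOp {N : ℕ} (q : ℝ[X]) {p : ℝ[X]}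
    (hN : p.natDegree < N) :
    aeval (derivative : ℝ[X] →ₗ[ℝ] ℝ[X]) q p = diffOp N (q : PowerSeries ℝ) p := by
  rw [aeval_eq_sum_range' (show q.natDegree < max N (q.natDegree + 1) by simp),
    LinearMap.sum_apply, diffOp]
  symm
  refine (Finset.sum_subset
    (Finset.range_subset_range.mpr (le_max_left N (q.natDegree + 1))) ?_).trans ?_
  · intro k _ hk
    rw [iterate_derivative_eq_zero (by simp at hk; omega), mul_zero]
  · refine Finset.sum_congr rfl fun k hk => ?_
    rw [coeff_coe, LinearMap.smul_apply, Module.End.pow_apply, smul_eq_C_mul]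

theorem Polynomial.iterate_diffOp {N : ℕ} (f : PowerSeries ℝ) {p : ℝ[X]} (hN : p.natDegree < N)
    (m : ℕ) : (diffOp N f)^[m] p = diffOp N (f ^ m) p := by
  have h : diffOp N f = aeval (derivative : ℝ[X] →ₗ[ℝ] ℝ[X]) (PowerSeries.trunc N f) :=
    _root_.funext (diffOp_eq_aeval f)
  rw [h, ← Module.End.pow_apply, ← map_pow, aeval_derivative_eq_diffOp _ hN, diffOp_eq_aeval,
    diffOp_eq_aeval, coe_pow, PowerSeries.trunc_trunc_pow]

theorem Polynomial.aeval_add_eq_sum (p : ℝ[X]) {N : ℕ} (hN : p.natDegree < N) (z h : ℂ) :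
    aeval (z + h) p =
      ∑ k ∈ Finset.range N, h ^ k / (Nat.factorial k : ℂ) * aeval z (derivative^[k] p) := by
  set P := p.map (algebraMap ℝ ℂ) with hP
  have hPN : (taylor z P).natDegree < N := by
    rw [natDegree_taylor]
    exact natDegree_map_le.trans_lt hN
  rw [← eval_map_algebraMap, ← hP, add_comm, ← taylor_eval, eval_eq_sum_range' hPN]
  refine Finset.sum_congr rfl fun k _ => ?_
  have hk : (Nat.factorial k : ℂ) ≠ 0 := Nat.cast_ne_zero.mpr (Nat.factorial_ne_zero k)
  rw [taylor_coeff, ← eval_map_algebraMap, ← iterate_derivative_map, ← hP,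
    ← factorial_smul_hasseDeriv]
  change _ = _ * eval z (Nat.factorial k • hasseDeriv k P)
  rw [eval_smul, nsmul_eq_mul]
  field_simp

theorem Polynomial.aeval_diffOp (N : ℕ) (f : PowerSeries ℝ) (p : ℝ[X]) (z : ℂ) :
    aeval z (diffOp N f p) =
      ∑ k ∈ Finset.range N, ((PowerSeries.coeff k f : ℝ) : ℂ) * aeval z (derivative^[k] p) := by
  simp [diffOp, map_sum]

/-- The power series of `cos (a x)`. -/
noncomputable def PowerSeries.cosMul (a : ℝ) : PowerSeries ℝ :=
  PowerSeries.rescale a (PowerSeries.cos ℝ)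

theorem PowerSeries.coeff_cosMul (a : ℝ) (k : ℕ) :
    PowerSeries.coeff k (PowerSeries.cosMul a) =
      if Even k then a ^ k * ((-1) ^ (k / 2) / (Nat.factorial k)) else 0 := by
  rw [cosMul, coeff_rescale, cos, coeff_mk]
  split_ifs <;> simp

theorem Polynomial.two_mul_aeval_diffOp_cosMul (p : ℝ[X]) {N : ℕ} (hN : p.natDegree < N) (a : ℝ)
    (z : ℂ) :
    2 * aeval z (diffOp N (PowerSeries.cosMul a) p) = aeval (z + a * I) p + aeval (z - a * I) p := by
  rw [sub_eq_add_neg, aeval_add_eq_sum p hN, aeval_add_eq_sum p hN, aeval_diffOp,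
    ← Finset.sum_add_distrib, Finset.mul_sum]
  refine Finset.sum_congr rfl fun k _ => ?_
  rw [← add_mul, ← mul_assoc]
  congr 1
  rw [PowerSeries.coeff_cosMul]
  rcases Nat.even_or_odd k with hk | hk
  · obtain ⟨j, rfl⟩ := hk
    rw [if_pos ⟨j, rfl⟩, ← two_mul, Nat.mul_div_cancel_left _ two_pos, pow_mul (-_), neg_sq,
      ← pow_mul, mul_pow, pow_mul I, I_sq]
    push_cast
    ring
  · rw [if_neg (Nat.not_even_iff_odd.mpr hk), hk.neg_pow]
    simp
    ring

theorem Complex.norm_sub_mul_norm_conj_sub_lt {z w : ℂ} {a : ℝ} (hz : 0 < z.im) (ha : 0 < a)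
    (h : w.im ^ 2 < z.im ^ 2 + a ^ 2) :
    ‖z - a * I - w‖ * ‖(starRingEnd ℂ) (z - a * I) - w‖ <
      ‖z + a * I - w‖ * ‖(starRingEnd ℂ) (z + a * I) - w‖ := by
  refine lt_of_pow_lt_pow_left₀ 2 (by positivity) ?_
  simp only [mul_pow, Complex.sq_norm, normSq_apply, sub_re, sub_im, add_re, add_im, mul_re, mul_im,
    conj_re, conj_im, ofReal_re, ofReal_im, I_re, I_im]
  have hya : 0 < z.im * a := mul_pos hz ha
  nlinarith [mul_pos hya (sub_pos.mpr h), mul_nonneg hya.le (sq_nonneg (z.re - w.re))]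

theorem Complex.norm_multisetProd_map (s : Multiset ℂ) (f : ℂ → ℂ) :
    ‖(s.map f).prod‖ = (s.map fun w => ‖f w‖).prod := by
  induction s using Multiset.induction with
  | empty => simp
  | cons a s ih => simp [ih]

theorem Polynomial.norm_aeval_sq_eq_prod (p : ℝ[X]) (z : ℂ) :
    ‖aeval z p‖ ^ 2 = ‖(p.leadingCoeff : ℂ)‖ ^ 2 * ((p.map (algebraMap ℝ ℂ)).roots.map
      fun w => ‖z - w‖ * ‖(starRingEnd ℂ) z - w‖).prod := by
  have h : ∀ z : ℂ, ‖aeval z p‖ = ‖(p.leadingCoeff : ℂ)‖ *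
      ((p.map (algebraMap ℝ ℂ)).roots.map fun w => ‖z - w‖).prod := by
    intro z
    rw [← eval_map_algebraMap, (IsAlgClosed.splits _).eval_eq_prod_roots, norm_mul,
      leadingCoeff_map, norm_multisetProd_map, coe_algebraMap]
  have hconj : ‖aeval ((starRingEnd ℂ) z) p‖ = ‖aeval z p‖ := by
    rw [aeval_conj, norm_conj]
  rw [Multiset.prod_map_mul, sq]
  nth_rw 2 [← hconj]
  rw [h, h]
  ring

theorem Polynomial.norm_aeval_sub_mul_I_lt {p : ℝ[X]} {s a : ℝ} (ha : 0 < a)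
    (hp : 0 < p.natDegree) (hroots : ∀ w : ℂ, aeval w p = 0 → w.im ^ 2 ≤ max s 0) {z : ℂ}
    (hz : 0 < z.im) (hzs : max (s - a ^ 2) 0 < z.im ^ 2) :
    ‖aeval (z - a * I) p‖ < ‖aeval (z + a * I) p‖ := by
  have hp0 : p ≠ 0 := ne_zero_of_natDegree_gt hp
  have hlt : ∀ w ∈ (p.map (algebraMap ℝ ℂ)).roots,
      ‖z - a * I - w‖ * ‖(starRingEnd ℂ) (z - a * I) - w‖ <
        ‖z + a * I - w‖ * ‖(starRingEnd ℂ) (z + a * I) - w‖ := by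
    intro w hw
    refine norm_sub_mul_norm_conj_sub_lt hz ha ?_
    have hw0 : aeval w p = 0 := by
      rw [← eval_map_algebraMap]
      exact isRoot_of_mem_roots hw
    have h := hroots w hw0
    have h₁ := (max_lt_iff.mp hzs).1
    have h₂ := (max_lt_iff.mp hzs).2
    rcases le_max_iff.mp h with h | h <;> nlinarith
  have hlead : 0 < ‖(p.leadingCoeff : ℂ)‖ ^ 2 := by
    have : (p.leadingCoeff : ℂ) ≠ 0 := ofReal_ne_zero.mpr (leadingCoeff_ne_zero.mpr hp0)
    positivity
  have hne : (p.map (algebraMap ℝ ℂ)).roots ≠ 0 := by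
    rw [← Multiset.card_pos, ← (IsAlgClosed.splits _).natDegree_eq_card_roots, natDegree_map]
    exact hp
  have hpos : 0 < ‖aeval (z + a * I) p‖ ^ 2 := by
    rw [norm_aeval_sq_eq_prod]
    refine mul_pos hlead (Multiset.prod_pos fun x hx => ?_)
    obtain ⟨w, hw, rfl⟩ := Multiset.mem_map.mp hx
    exact (by positivity : (0 : ℝ) ≤ _).trans_lt (hlt w hw)
  rcases eq_or_ne (aeval (z - a * I) p) 0 with h0 | h0
  · rw [h0, norm_zero]
    exact (sq_pos_iff.mp hpos).lt_of_le' (norm_nonneg _)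
  · refine lt_of_pow_lt_pow_left₀ 2 (norm_nonneg _) ?_
    rw [norm_aeval_sq_eq_prod, norm_aeval_sq_eq_prod]
    refine mul_lt_mul_of_pos_left (Multiset.prod_map_lt_prod_map hne _ _ ?_ hlt) hlead
    intro w hw
    have hw0 : aeval w p = 0 := by
      rw [← eval_map_algebraMap]
      exact isRoot_of_mem_roots hw
    have h₁ : z - a * I - w ≠ 0 := fun h => h0 (by rwa [sub_eq_zero.mp h])
    have h₂ : (starRingEnd ℂ) (z - a * I) - w ≠ 0 := by
      intro h
      rw [← sub_eq_zero.mp h, aeval_conj, map_eq_zero] at hw0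
      exact h0 hw0
    positivity

/-- One averaging step along the imaginary direction shrinks the strip of zeros. -/
theorem Polynomial.sq_im_le_of_aeval_diffOp_cosMul_eq_zero {p : ℝ[X]} {s a : ℝ} {N : ℕ}
    (hN : p.natDegree < N) (ha : 0 < a)
    (hroots : ∀ w : ℂ, aeval w p = 0 → w.im ^ 2 ≤ max s 0) (z : ℂ)
    (hz : aeval z (diffOp N (PowerSeries.cosMul a) p) = 0) :
    z.im ^ 2 ≤ max (s - a ^ 2) 0 := by
  have upper : ∀ z : ℂ, aeval z (diffOp N (PowerSeries.cosMul a) p) = 0 → 0 < z.im →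
      z.im ^ 2 ≤ max (s - a ^ 2) 0 := by
    intro z hz him
    by_contra! hlt
    have hsum := two_mul_aeval_diffOp_cosMul p hN a z
    rw [hz, mul_zero] at hsum
    rcases Nat.eq_zero_or_pos p.natDegree with hp | hp
    · rw [eq_C_of_natDegree_eq_zero hp] at hsum hroots
      simp only [aeval_C] at hsum hroots
      have h0 : (algebraMap ℝ ℂ) (p.coeff 0) = 0 := by linear_combination -hsum / 2
      have h1 := hroots (((|s| + 1 : ℝ) : ℂ) * I) h0
      have h2 : max s 0 ≤ |s| := max_le (le_abs_self s) (abs_nonneg s)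
      simp only [im_ofReal_mul, I_im, mul_one] at h1
      nlinarith [abs_nonneg s]
    · have h := norm_aeval_sub_mul_I_lt ha hp hroots him hlt
      rw [← neg_eq_of_add_eq_zero_left hsum.symm, norm_neg] at h
      exact lt_irrefl _ h
  rcases lt_trichotomy z.im 0 with him | him | him
  · have h := upper ((starRingEnd ℂ) z) (by rw [aeval_conj, hz, map_zero]) (by simpa using him)
    simpa using h
  · simp [him]
  · exact upper z hz him

theorem Polynomial.sq_im_le_of_aeval_iterate_diffOp_cosMul_eq_zero {p : ℝ[X]} {s a : ℝ} {N : ℕ}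
    (hN : p.natDegree < N) (ha : 0 < a)
    (hroots : ∀ w : ℂ, aeval w p = 0 → w.im ^ 2 ≤ max s 0) (m : ℕ) (z : ℂ)
    (hz : aeval z (diffOp N (PowerSeries.cosMul a ^ m) p) = 0) :
    z.im ^ 2 ≤ max (s - m * a ^ 2) 0 := by
  induction m generalizing z with
  | zero =>
    rw [← iterate_diffOp _ hN] at hz
    simpa using hroots z hz
  | succ m ih =>
    rw [← iterate_diffOp _ hN, Function.iterate_succ_apply', iterate_diffOp _ hN] at hz
    have h := sq_im_le_of_aeval_diffOp_cosMul_eq_zero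
      ((natDegree_diffOp_le N _ p).trans_lt hN) ha ih z hz
    convert h using 2
    push_cast
    ring

theorem Polynomial.norm_leadingCoeff_mul_pow_le {q : ℂ[X]} {z : ℂ} {ε : ℝ} (hε : 0 ≤ ε)
    (h : ∀ w ∈ q.roots, ε ≤ ‖z - w‖) : ‖q.leadingCoeff‖ * ε ^ q.natDegree ≤ ‖q.eval z‖ := by
  rw [(IsAlgClosed.splits q).eval_eq_prod_roots, norm_mul,
    norm_multisetProd_map, (IsAlgClosed.splits q).natDegree_eq_card_roots]
  refine mul_le_mul_of_nonneg_left ?_ (norm_nonneg _)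
  rw [← Multiset.prod_replicate, ← Multiset.map_const']
  exact Multiset.prod_map_le_prod_map₀ _ _ (fun _ _ => hε) h

open Filter Topology in
/-- A Hurwitz-type statement: strips containing all zeros persist under pointwise limits of
polynomials with fixed degree and leading coefficient. -/
theorem Polynomial.abs_im_le_of_tendsto {q : ℕ → ℝ[X]} {n : ℕ} {c δ : ℝ} (hc : c ≠ 0)
    (hdeg : ∀ m, (q m).natDegree = n) (hlead : ∀ m, (q m).leadingCoeff = c)
    (hroots : ∀ m, ∀ w : ℂ, aeval w (q m) = 0 → |w.im| ≤ δ) {z : ℂ}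
    (hlim : Tendsto (fun m => aeval z (q m)) atTop (𝓝 0)) : |z.im| ≤ δ := by
  by_contra! hlt
  have hε : 0 < |z.im| - δ := sub_pos.mpr hlt
  have hbound : ∀ m, ‖(c : ℂ)‖ * (|z.im| - δ) ^ n ≤ ‖aeval z (q m)‖ := by
    intro m
    have h := norm_leadingCoeff_mul_pow_le (q := (q m).map (algebraMap ℝ ℂ)) (z := z) hε.le ?_
    · rwa [leadingCoeff_map, natDegree_map, hdeg, hlead, eval_map_algebraMap] at h
    · intro w hw
      have hw0 : aeval w (q m) = 0 := by
        rw [← eval_map_algebraMap]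
        exact isRoot_of_mem_roots hw
      have h1 := abs_im_le_norm (z - w)
      have h2 := abs_sub_abs_le_abs_sub z.im w.im
      rw [← sub_im] at h2
      linarith [hroots m w hw0]
  have h := ge_of_tendsto' hlim.norm hbound
  rw [norm_zero] at h
  have hc' : 0 < ‖(c : ℂ)‖ := norm_pos_iff.mpr (ofReal_ne_zero.mpr hc)
  exact absurd h (not_le.mpr (by positivity))

/-- The power series of `exp (-l x²)`. -/
noncomputable def PowerSeries.gaussian (l : ℝ) : PowerSeries ℝ :=
  PowerSeries.mk fun k => if Even k then (-l) ^ (k / 2) / (Nat.factorial (k / 2)) else 0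

theorem PowerSeries.derivative_gaussian (l : ℝ) :
    PowerSeries.derivative ℝ (PowerSeries.gaussian l) =
      PowerSeries.derivative ℝ (PowerSeries.C (-l) * PowerSeries.X ^ 2) *
        PowerSeries.gaussian l := by
  have h : PowerSeries.derivative ℝ (PowerSeries.C (-l) * PowerSeries.X ^ 2) =
      PowerSeries.C (-2 * l) * PowerSeries.X := by
    rw [Derivation.leibniz, PowerSeries.derivative_pow, PowerSeries.derivative_C,
      PowerSeries.derivative_X]
    simp only [Nat.cast_ofNat, Nat.add_one_sub_one, pow_one, smul_eq_mul, mul_one, mul_zero,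
      add_zero, neg_mul, map_neg, map_mul, map_ofNat]
    ring
  rw [h, mul_assoc]
  ext k
  rw [coeff_C_mul, coeff_derivative]
  rcases k with _ | k
  · simp [gaussian]
  · rw [coeff_succ_X_mul, gaussian, coeff_mk, coeff_mk]
    rcases Nat.even_or_odd k with hk | hk
    · obtain ⟨j, rfl⟩ := hk
      have h1 : (j + j + 1 + 1) / 2 = j + 1 := by omega
      have h2 : (j + j) / 2 = j := by omega
      rw [if_pos (by grind), if_pos (by grind), h1, h2, Nat.factorial_succ]
      have : (Nat.factorial j : ℝ) ≠ 0 := by positivity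
      push_cast
      field_simp
      ring
    · rw [if_neg (by grind), if_neg (by grind)]
      simp

open Filter Topology in
theorem PowerSeries.tendsto_coeff_cosMul_pow {l : ℝ} (hl : 0 ≤ l) (k : ℕ) :
    Tendsto (fun m : ℕ => PowerSeries.coeff k
      (PowerSeries.cosMul (Real.sqrt (2 * l / ((m : ℝ) + 1))) ^ (m + 1))) atTop
      (𝓝 (PowerSeries.coeff k (PowerSeries.gaussian l))) := by
  refine tendsto_coeff_pow _ (C (-l) * X ^ 2) _ (fun m => ?_) (fun k => ?_) ?_
    (derivative_gaussian l) k
  · simp [coeff_cosMul]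
  · simp only [coeff_cosMul, coeff_C_mul, coeff_X_pow]
    rcases Nat.even_or_odd (k + 1) with hk | hk
    · obtain ⟨j, hj⟩ := hk
      obtain ⟨i, rfl⟩ : ∃ i, j = i + 1 := ⟨j - 1, by omega⟩
      have hsq : ∀ m : ℕ, ((m : ℝ) + 1) * (if Even (k + 1) then
          Real.sqrt (2 * l / ((m : ℝ) + 1)) ^ (k + 1) *
            ((-1) ^ ((k + 1) / 2) / (Nat.factorial (k + 1))) else 0) =
          (1 / ((m : ℝ) + 1)) ^ i *
            ((2 * l) ^ (i + 1) * ((-1) ^ (i + 1) / (Nat.factorial (k + 1)))) := by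
        intro m
        have hm : (0 : ℝ) < (m : ℝ) + 1 := by positivity
        have hdiv : (i + 1 + (i + 1)) / 2 = i + 1 := by omega
        rw [if_pos ⟨_, hj⟩, hj, hdiv, ← two_mul, pow_mul, Real.sq_sqrt (by positivity),
          div_pow, div_pow, one_pow, pow_succ ((m : ℝ) + 1)]
        field_simp
      simp only [hsq]
      have h := ((tendsto_one_div_add_atTop_nhds_zero_nat (𝕜 := ℝ)).pow i).mul_const
        ((2 * l) ^ (i + 1) * ((-1) ^ (i + 1) / (Nat.factorial (k + 1) : ℝ)))
      convert h using 2
      rcases i with _ | i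
      · obtain rfl : k = 1 := by omega
        norm_num
        ring
      · rw [if_neg (by omega)]
        simp
    · have h2 : k + 1 ≠ 2 := by grind
      simp [if_neg (Nat.not_even_iff_odd.mpr hk), h2]
  · simp [gaussian]

theorem Finset.sum_range_two_mul_eq {M : Type*} [AddCommMonoid M] (F : ℕ → M) (n : ℕ)
    (hodd : ∀ k, F (2 * k + 1) = 0) :
    ∑ k ∈ Finset.range (2 * n), F k = ∑ k ∈ Finset.range n, F (2 * k) := by
  induction n with
  | zero => simp
  | succ n ih =>
    rw [mul_add, Finset.sum_range_succ, Finset.sum_range_succ, ih, hodd, add_zero,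
      Finset.sum_range_succ]

theorem Polynomial.diffOp_gaussian (M : ℕ) (l : ℝ) (p : ℝ[X]) :
    diffOp (2 * M) (PowerSeries.gaussian l) p =
      ∑ k ∈ Finset.range M, C ((-1 : ℝ) ^ k * l ^ k / (Nat.factorial k)) *
        derivative^[2 * k] p := by
  rw [diffOp, Finset.sum_range_two_mul_eq]
  · refine Finset.sum_congr rfl fun k _ => ?_
    rw [PowerSeries.gaussian, PowerSeries.coeff_mk, if_pos (even_two_mul k),
      Nat.mul_div_cancel_left _ two_pos, neg_pow]
  · intro k
    rw [PowerSeries.gaussian, PowerSeries.coeff_mk, if_neg (by grind), C_0, zero_mul]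

open Filter Topology in
theorem stmt_16 (p : Polynomial ℝ) (hn : 1 ≤ p.natDegree)
    (μ l : ℝ) (hμ : 0 ≤ μ) (hl : 0 ≤ l)
    (hroots : ∀ z : ℂ, Polynomial.aeval z p = 0 → |z.im| ≤ μ) :
    ∀ z : ℂ,
      Polynomial.aeval z
        (∑ k ∈ Finset.range (p.natDegree / 2 + 1),
          Polynomial.C ((-1 : ℝ) ^ k * l ^ k / (Nat.factorial k)) *
            (Polynomial.derivative^[2 * k] p)) = 0 →
      |z.im| ≤ Real.sqrt (max (μ ^ 2 - 2 * l) 0) := by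
  intro z hz
  have hstrip : ∀ w : ℂ, aeval w p = 0 → w.im ^ 2 ≤ max (μ ^ 2) 0 := fun w hw =>
    le_max_of_le_left (sq_le_sq' (by linarith [(abs_le.mp (hroots w hw)).1])
      (abs_le.mp (hroots w hw)).2)
  have hp : p ≠ 0 := ne_zero_of_natDegree_gt hn
  rcases hl.eq_or_lt with rfl | hl
  · rw [Finset.sum_range_succ', Finset.sum_eq_zero (by simp)] at hz
    rw [mul_zero, sub_zero]
    exact Real.abs_le_sqrt (hstrip z (by simpa using hz))
  · rw [← diffOp_gaussian] at hz
    set N := 2 * (p.natDegree / 2 + 1) with hNdef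
    have hN : p.natDegree < N := by omega
    set a : ℕ → ℝ := fun m => Real.sqrt (2 * l / ((m : ℝ) + 1)) with ha
    have hcoeff : ∀ m, (diffOp N (PowerSeries.cosMul (a m) ^ (m + 1)) p).coeff p.natDegree =
        p.leadingCoeff := by
      intro m
      have h : PowerSeries.coeff 0 (PowerSeries.cosMul (a m)) = 1 := by
        simp [PowerSeries.coeff_cosMul]
      rw [PowerSeries.coeff_zero_eq_constantCoeff] at h
      rw [coeff_natDegree_diffOp _ hN, PowerSeries.coeff_zero_eq_constantCoeff, map_pow, h,
        one_pow, one_mul]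
    have hdeg : ∀ m, (diffOp N (PowerSeries.cosMul (a m) ^ (m + 1)) p).natDegree =
        p.natDegree := fun m =>
      natDegree_eq_of_le_of_coeff_ne_zero (natDegree_diffOp_le N _ p)
        (by rw [hcoeff]; exact leadingCoeff_ne_zero.mpr hp)
    refine abs_im_le_of_tendsto (q := fun m => diffOp N (PowerSeries.cosMul (a m) ^ (m + 1)) p)
      (leadingCoeff_ne_zero.mpr hp) hdeg
      (fun m => by rw [leadingCoeff, hdeg, hcoeff]) (fun m w hw => Real.abs_le_sqrt ?_) ?_
    · have hm : (0 : ℝ) < (m : ℝ) + 1 := by positivity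
      have h := sq_im_le_of_aeval_iterate_diffOp_cosMul_eq_zero hN
        (Real.sqrt_pos.mpr (by positivity)) hstrip (m + 1) w hw
      rw [Real.sq_sqrt (by positivity), Nat.cast_succ, mul_div_cancel₀ _ hm.ne'] at h
      exact h
    · rw [← hz]
      simp only [aeval_diffOp]
      refine tendsto_finsetSum _ fun k _ => Tendsto.mul_const _ ?_
      exact (continuous_ofReal.tendsto _).comp (PowerSeries.tendsto_coeff_cosMul_pow hl.le k)
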